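/- arXiv:0712.2888 — 6 statements merged into one kernel-verified Lean document; each statement's English description precedes it below -/
import Mathlib

section
/- Let n ≥ 1 and 0 ≤ k ≤ n. Let H be a full-rank (n−k)×n matrix over F_2 and G a full-rank k×n matrix over F_2 satisfying G Hᵀ = 0. Then there exist an n×k matrix G⁻¹ and an n×(n−k) matrix H⁻¹ over F_2 such that G G⁻¹ = I_k, H H⁻¹ = I_{n−k}, and (H⁻¹)ᵀ G⁻¹ = 0. -/
open Matrix

/-- A matrix over a field with linearly independent rows has a right inverse. -/
theorem Matrix.exists_mul_eq_one_of_linearIndependent_row {K m n : Type*} [Field K] [Fintype m]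
    [DecidableEq m] [Fintype n] [DecidableEq n] (A : Matrix m n K)
    (hA : LinearIndependent K A.row) : ∃ B : Matrix n m K, A * B = 1 := by
  have h : LinearMap.ker (Matrix.toLin' Aᵀ) = ⊥ := by
    refine LinearMap.ker_eq_bot.mpr ?_
    intro x y hxy
    simp only [Matrix.toLin'_apply, Matrix.mulVec_transpose] at hxy
    exact Matrix.vecMul_injective_iff.mpr hA hxy
  obtain ⟨g, hg⟩ := (Matrix.toLin' Aᵀ).exists_leftInverse_of_injective h
  refine ⟨(LinearMap.toMatrix' g)ᵀ, ?_⟩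
  have h' := congrArg LinearMap.toMatrix' hg
  rw [LinearMap.toMatrix'_comp, LinearMap.toMatrix'_toLin', LinearMap.toMatrix'_id] at h'
  simpa using congrArg Matrix.transpose h'

/-- Let n ≥ 1 and 0 ≤ k ≤ n. Let H be a full-rank (n−k)×n matrix over F_2 and
G a full-rank k×n matrix over F_2 satisfying G Hᵀ = 0. Then there exist an n×k matrix G⁻¹ and
an n×(n−k) matrix H⁻¹ over F_2 such that G G⁻¹ = I_k, H H⁻¹ = I_{n−k}, and (H⁻¹)ᵀ G⁻¹ = 0. -/
theorem stmt_0 (n k : ℕ) (hn : 1 ≤ n) (hk : k ≤ n)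
    (H : Matrix (Fin (n - k)) (Fin n) (ZMod 2)) (G : Matrix (Fin k) (Fin n) (ZMod 2))
    (hHrank : LinearIndependent (ZMod 2) (fun i => H i))
    (hGrank : LinearIndependent (ZMod 2) (fun i => G i))
    (hGH : G * Hᵀ = 0) :
    ∃ (Ginv : Matrix (Fin n) (Fin k) (ZMod 2)) (Hinv : Matrix (Fin n) (Fin (n - k)) (ZMod 2)),
      G * Ginv = 1 ∧ H * Hinv = 1 ∧ Hinvᵀ * Ginv = 0 := by
  obtain ⟨A, hA⟩ := G.exists_mul_eq_one_of_linearIndependent_row hGrank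
  obtain ⟨B, hB⟩ := H.exists_mul_eq_one_of_linearIndependent_row hHrank
  refine ⟨A - Hᵀ * (Bᵀ * A), B, ?_, hB, ?_⟩
  · rw [Matrix.mul_sub, ← Matrix.mul_assoc, hGH, hA, Matrix.zero_mul, sub_zero]
  · rw [Matrix.mul_sub, ← Matrix.mul_assoc, ← Matrix.transpose_mul, hB, Matrix.transpose_one,
      Matrix.one_mul, sub_self]
end

section
/- Let V be a unitary 2ⁿ×2ⁿ complex matrix and M a 2n×2n matrix over F_2 such that for every v ∈ F_2^{2n} there exists a scalar c ∈ ℂ with V 𝒫(v) V† = c · 𝒫(v M). Then M is symplectic: M Λ_n Mᵀ = Λ_n. -/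
open Matrix

/-- The 2N×2N binary matrix Λ_N, block diagonal with N copies of [[0,1],[1,0]]. -/
def lambdaMat (N : ℕ) : Matrix (Fin (2 * N)) (Fin (2 * N)) (ZMod 2) :=
  Matrix.of fun i j => if i.val / 2 = j.val / 2 ∧ i ≠ j then 1 else 0

/-- The single-qubit Pauli matrices: σ(0,0)=I, σ(1,0)=X, σ(1,1)=Y, σ(0,1)=Z. -/
def pauliOne (a b : ZMod 2) : Matrix (Fin 2) (Fin 2) ℂ :=
  if a = 0 then
    (if b = 0 then 1 else !![1, 0; 0, -1])
  else
    (if b = 0 then !![0, 1; 1, 0] else !![0, -Complex.I; Complex.I, 0])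

/-- The n-fold Kronecker product 𝒫(v) = σ(v¹,v²) ⊗ ⋯ ⊗ σ(v^{2n−1},v^{2n}), realized on the
index set Fin n → Fin 2 (binary strings of length n). -/
def pauliMat (n : ℕ) (v : Fin (2 * n) → ZMod 2) :
    Matrix (Fin n → Fin 2) (Fin n → Fin 2) ℂ :=
  Matrix.of fun x y => ∏ i : Fin n,
    pauliOne (v ⟨2 * i.val, by have := i.isLt; omega⟩)
      (v ⟨2 * i.val + 1, by have := i.isLt; omega⟩) (x i) (y i)

lemma ZMod.eq_zero_or_eq_one_of_two (a : ZMod 2) : a = 0 ∨ a = 1 := by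
  revert a
  decide

/-- The sign character `a ↦ (-1)ᵃ` of `ZMod 2`. -/
def signChar : AddChar (ZMod 2) ℂ where
  toFun a := if a = 0 then 1 else -1
  map_zero_eq_one' := by simp
  map_add_eq_mul' := by
    have h : (1 : ZMod 2) + 1 = 0 := by decide
    intro a b
    rcases ZMod.eq_zero_or_eq_one_of_two a with rfl | rfl <;>
    rcases ZMod.eq_zero_or_eq_one_of_two b with rfl | rfl <;> simp [h]

lemma signChar_apply (a : ZMod 2) : signChar a = if a = 0 then 1 else -1 := rfl

lemma signChar_sum {ι : Type*} (s : Finset ι) (f : ι → ZMod 2) :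
    signChar (∑ i ∈ s, f i) = ∏ i ∈ s, signChar (f i) := by
  classical
  induction s using Finset.induction_on with
  | empty => simp
  | insert a s ha ih => rw [Finset.sum_insert ha, Finset.prod_insert ha, AddChar.map_add_eq_mul, ih]

lemma signChar_injective : Function.Injective signChar := by
  intro a b
  rcases ZMod.eq_zero_or_eq_one_of_two a with rfl | rfl <;>
    rcases ZMod.eq_zero_or_eq_one_of_two b with rfl | rfl <;> norm_num [signChar_apply]

lemma pauliOne_mul_comm (a b c d : ZMod 2) :
    pauliOne a b * pauliOne c d = signChar (a * d + b * c) • (pauliOne c d * pauliOne a b) := by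
  have h : (1 : ZMod 2) + 1 = 0 := by decide
  rcases ZMod.eq_zero_or_eq_one_of_two a with rfl | rfl <;>
    rcases ZMod.eq_zero_or_eq_one_of_two b with rfl | rfl <;>
    rcases ZMod.eq_zero_or_eq_one_of_two c with rfl | rfl <;>
    rcases ZMod.eq_zero_or_eq_one_of_two d with rfl | rfl <;>
    simp [pauliOne, signChar_apply, h, Matrix.one_fin_two]

lemma pauliOne_mul_self (a b : ZMod 2) : pauliOne a b * pauliOne a b = 1 := by
  rcases ZMod.eq_zero_or_eq_one_of_two a with rfl | rfl <;>
    rcases ZMod.eq_zero_or_eq_one_of_two b with rfl | rfl <;> simp [pauliOne, Matrix.one_fin_two]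

lemma pauliMat_mul_apply (n : ℕ) (u v : Fin (2 * n) → ZMod 2) (x y : Fin n → Fin 2) :
    (pauliMat n u * pauliMat n v) x y = ∏ i : Fin n,
      (pauliOne (u ⟨2 * i.val, by have := i.isLt; omega⟩)
          (u ⟨2 * i.val + 1, by have := i.isLt; omega⟩) *
        pauliOne (v ⟨2 * i.val, by have := i.isLt; omega⟩)
          (v ⟨2 * i.val + 1, by have := i.isLt; omega⟩)) (x i) (y i) := by
  simp only [Matrix.mul_apply, pauliMat, Matrix.of_apply, ← Finset.prod_mul_distrib]
  rw [Finset.prod_univ_sum, Fintype.piFinset_univ]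

lemma pauliMat_mul_self (n : ℕ) (v : Fin (2 * n) → ZMod 2) :
    pauliMat n v * pauliMat n v = 1 := by
  ext x y
  rw [pauliMat_mul_apply]
  simp only [pauliOne_mul_self, Matrix.one_apply]
  rw [Fintype.prod_ite_zero]
  simp [funext_iff]

lemma sum_fin_two_mul {α : Type*} [AddCommMonoid α] (n : ℕ) (f : Fin (2 * n) → α) :
    ∑ k, f k = ∑ i : Fin n, (f ⟨2 * i.val, by have := i.isLt; omega⟩ +
      f ⟨2 * i.val + 1, by have := i.isLt; omega⟩) := by
  rw [← Equiv.sum_comp (finProdFinEquiv.trans (finCongr (Nat.mul_comm n 2))),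
    Fintype.sum_prod_type]
  refine Finset.sum_congr rfl fun i _ => ?_
  rw [Fin.sum_univ_two]
  congr 2 <;> ext <;> simp [Nat.add_comm]

lemma dotProduct_lambdaMat_mulVec (n : ℕ) (u v : Fin (2 * n) → ZMod 2) :
    u ⬝ᵥ (lambdaMat n *ᵥ v) = ∑ i : Fin n,
      (u ⟨2 * i.val, by have := i.isLt; omega⟩ * v ⟨2 * i.val + 1, by have := i.isLt; omega⟩ +
        u ⟨2 * i.val + 1, by have := i.isLt; omega⟩ *
          v ⟨2 * i.val, by have := i.isLt; omega⟩) := by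
  have hdiv (m : ℕ) : (2 * m + 1) / 2 = m := by omega
  have hne (a b : ℕ) : 2 * a + 1 ≠ 2 * b := by omega
  simp only [dotProduct, Matrix.mulVec, sum_fin_two_mul, lambdaMat, Matrix.of_apply]
  refine Finset.sum_congr rfl fun i _ => ?_
  congr 2
  · rw [Finset.sum_eq_single i]
    · simp [hdiv]
    · intro j _ hj
      have : (i : ℕ) ≠ j := fun h => hj (Fin.ext h.symm)
      simp [hdiv, this]
    · simp
  · rw [Finset.sum_eq_single i]
    · simp [hdiv]
    · intro j _ hj
      have : (i : ℕ) ≠ j := fun h => hj (Fin.ext h.symm)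
      simp [hdiv, this]
    · simp

lemma pauliMat_mul_comm (n : ℕ) (u v : Fin (2 * n) → ZMod 2) :
    pauliMat n u * pauliMat n v =
      signChar (u ⬝ᵥ (lambdaMat n *ᵥ v)) • (pauliMat n v * pauliMat n u) := by
  ext x y
  rw [Matrix.smul_apply, pauliMat_mul_apply, pauliMat_mul_apply, dotProduct_lambdaMat_mulVec,
    signChar_sum, smul_eq_mul, ← Finset.prod_mul_distrib]
  refine Finset.prod_congr rfl fun i _ => ?_
  rw [pauliOne_mul_comm, Matrix.smul_apply, smul_eq_mul]

lemma pauliMat_mul_ne_zero (n : ℕ) (u v : Fin (2 * n) → ZMod 2) :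
    pauliMat n u * pauliMat n v ≠ 0 := by
  intro h
  have h1 : pauliMat n u * (pauliMat n u * pauliMat n v) * pauliMat n v = 1 := by
    rw [← Matrix.mul_assoc, pauliMat_mul_self, Matrix.one_mul, pauliMat_mul_self]
  rw [h] at h1
  simp at h1

/-- the binary encoding matrix M of a Clifford transformation V
(V 𝒫(v) V† = c · 𝒫(v M) for each v, for some scalar c) is symplectic: M Λ_n Mᵀ = Λ_n. -/
theorem stmt_6 (n : ℕ) (hn : 1 ≤ n)
    (V : Matrix (Fin n → Fin 2) (Fin n → Fin 2) ℂ)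
    (hV : V ∈ Matrix.unitaryGroup (Fin n → Fin 2) ℂ)
    (M : Matrix (Fin (2 * n)) (Fin (2 * n)) (ZMod 2))
    (hM : ∀ v : Fin (2 * n) → ZMod 2, ∃ c : ℂ,
      V * pauliMat n v * Vᴴ = c • pauliMat n (Matrix.vecMul v M)) :
    M * lambdaMat n * Mᵀ = lambdaMat n := by
  have hVV : Vᴴ * V = 1 := Matrix.mem_unitaryGroup_iff'.mp hV
  have hVV' : V * Vᴴ = 1 := Matrix.mem_unitaryGroup_iff.mp hV
  have conj_mul (A B : Matrix (Fin n → Fin 2) (Fin n → Fin 2) ℂ) :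
      V * A * Vᴴ * (V * B * Vᴴ) = V * (A * B) * Vᴴ := by
    calc V * A * Vᴴ * (V * B * Vᴴ) = V * A * (Vᴴ * V) * B * Vᴴ := by
          simp only [Matrix.mul_assoc]
      _ = V * (A * B) * Vᴴ := by rw [hVV, Matrix.mul_one, Matrix.mul_assoc V]
  have conj_ne_zero (A : Matrix (Fin n → Fin 2) (Fin n → Fin 2) ℂ) (hA : A ≠ 0) :
      V * A * Vᴴ ≠ 0 := by
    intro h
    apply hA
    calc A = Vᴴ * V * A * (Vᴴ * V) := by rw [hVV, Matrix.one_mul, Matrix.mul_one]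
      _ = Vᴴ * (V * A * Vᴴ) * V := by simp only [Matrix.mul_assoc]
      _ = 0 := by rw [h, Matrix.mul_zero, Matrix.zero_mul]
  have form_eq (u v : Fin (2 * n) → ZMod 2) :
      (u ᵥ* M) ⬝ᵥ (lambdaMat n *ᵥ (v ᵥ* M)) = u ⬝ᵥ (lambdaMat n *ᵥ v) := by
    obtain ⟨c, hc⟩ := hM u
    obtain ⟨d, hd⟩ := hM v
    apply signChar_injective
    apply smul_left_injective ℂ (conj_ne_zero _ (pauliMat_mul_ne_zero n v u))
    calc signChar ((u ᵥ* M) ⬝ᵥ (lambdaMat n *ᵥ (v ᵥ* M))) •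
          (V * (pauliMat n v * pauliMat n u) * Vᴴ)
        = V * (pauliMat n u * pauliMat n v) * Vᴴ := by
          rw [← conj_mul, ← conj_mul, hc, hd]
          simp only [Matrix.smul_mul, Matrix.mul_smul]
          rw [pauliMat_mul_comm n (u ᵥ* M)]
          simp only [smul_smul]
          congr 1
          ring
      _ = signChar (u ⬝ᵥ (lambdaMat n *ᵥ v)) •
          (V * (pauliMat n v * pauliMat n u) * Vᴴ) := by
          rw [pauliMat_mul_comm n u v, Matrix.mul_smul, Matrix.smul_mul]
  ext i j
  have h := form_eq (Pi.single i 1) (Pi.single j 1)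
  rw [← Matrix.mulVec_transpose M (Pi.single j 1), ← Matrix.dotProduct_mulVec,
    Matrix.mulVec_mulVec, Matrix.mulVec_mulVec] at h
  simpa [Matrix.mul_assoc] using h
end

section
/- Let U be a seed transformation with blocks as above. The subspace of F_2^{2(n+m)} consisting of all vectors orthogonal, under the Λ_{n+m}-symplectic product, to every row of U_eff is exactly the row space of [Σ_P Σ_M]. Similarly, the subspace of all vectors orthogonal to every row of [μ_P μ_M] and every row of [Σ_P Σ_M] is exactly the span of the rows of [Λ_P Λ_M] together with the rows of [Σ_P Σ_M]. -/
open Matrix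

/-- The symplectic product P ⋆ Q = P Λ_N Qᵀ of row vectors P, Q ∈ F_2^{2N}. -/
def sstar {N : ℕ} (P Q : Fin (2 * N) → ZMod 2) : ZMod 2 :=
  Matrix.vecMul P (lambdaMat N) ⬝ᵥ Q

/-- A 2N×2N binary matrix is symplectic if U Λ_N Uᵀ = Λ_N.  A seed transformation of a
quantum convolutional encoder with parameters (n,k,m) is a symplectic 2(n+m)×2(n+m) matrix. -/
def IsSymplectic {N : ℕ} (U : Matrix (Fin (2 * N)) (Fin (2 * N)) (ZMod 2)) : Prop :=
  U * lambdaMat N * Uᵀ = lambdaMat N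


/-- Row i of the block [μ_P μ_M] of U_eff, i.e. row i (0-indexed, i < 2m) of U. -/
def muRow (n m : ℕ) (U : Matrix (Fin (2 * (n + m))) (Fin (2 * (n + m))) (ZMod 2))
    (i : Fin (2 * m)) : Fin (2 * (n + m)) → ZMod 2 :=
  fun j => U ⟨i.val, by have := i.isLt; omega⟩ j

/-- Row i of the block [Λ_P Λ_M] of U_eff, i.e. row 2m+i (0-indexed, i < 2k) of U. -/
def lamRow (n k m : ℕ) (hk : k ≤ n)
    (U : Matrix (Fin (2 * (n + m))) (Fin (2 * (n + m))) (ZMod 2))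
    (i : Fin (2 * k)) : Fin (2 * (n + m)) → ZMod 2 :=
  fun j => U ⟨2 * m + i.val, by have := i.isLt; omega⟩ j

/-- Row i of the block [Σ_P Σ_M] of U_eff, i.e. row 2m+2k+2i (1-indexed, i = 1,…,n−k)
of U. -/
def sigRow (n k m : ℕ)
    (U : Matrix (Fin (2 * (n + m))) (Fin (2 * (n + m))) (ZMod 2))
    (i : Fin (n - k)) : Fin (2 * (n + m)) → ZMod 2 :=
  fun j => U ⟨2 * m + 2 * k + 2 * i.val + 1, by have := i.isLt; omega⟩ j

/-- The index paired with `i` by `lambdaMat`. -/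
def partner {N : ℕ} (i : Fin (2 * N)) : Fin (2 * N) :=
  ⟨if i.val % 2 = 0 then i.val + 1 else i.val - 1, by have := i.isLt; split_ifs <;> omega⟩

lemma partner_val {N : ℕ} (i : Fin (2 * N)) :
    (partner i).val = if i.val % 2 = 0 then i.val + 1 else i.val - 1 := rfl

lemma lambdaMat_apply {N : ℕ} (i j : Fin (2 * N)) :
    lambdaMat N i j = if i = partner j then 1 else 0 := by
  simp only [lambdaMat, Matrix.of_apply]
  congr 1
  simp only [ne_eq, Fin.ext_iff, partner_val, eq_iff_iff]
  split_ifs <;> omega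

lemma partner_partner {N : ℕ} (i : Fin (2 * N)) : partner (partner i) = i := by
  simp only [Fin.ext_iff, partner_val]
  split_ifs <;> omega

lemma vecMul_lambdaMat {N : ℕ} (v : Fin (2 * N) → ZMod 2) (j : Fin (2 * N)) :
    (v ᵥ* lambdaMat N) j = v (partner j) := by
  simp [Matrix.vecMul, dotProduct, lambdaMat_apply]

lemma lambdaMat_mul_self (N : ℕ) : lambdaMat N * lambdaMat N = 1 := by
  ext i j
  rw [Matrix.mul_apply_eq_vecMul, vecMul_lambdaMat, lambdaMat_apply, partner_partner,
    Matrix.one_apply]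

lemma sstar_row_row {N : ℕ} {U : Matrix (Fin (2 * N)) (Fin (2 * N)) (ZMod 2)}
    (hU : IsSymplectic U) (a b : Fin (2 * N)) :
    sstar (U a) (U b) = if a = partner b then 1 else 0 := by
  rw [← lambdaMat_apply, ← hU, Matrix.mul_apply, sstar, dotProduct]
  simp only [Matrix.mul_apply_eq_vecMul, Matrix.transpose_apply]

lemma sum_sstar_smul_row {N : ℕ} {U : Matrix (Fin (2 * N)) (Fin (2 * N)) (ZMod 2)}
    (hU : IsSymplectic U) (v : Fin (2 * N) → ZMod 2) :
    ∑ a, sstar v (U (partner a)) • U a = v := by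
  have hinv : lambdaMat N * Uᵀ * lambdaMat N * U = 1 := by
    rw [mul_eq_one_comm, ← mul_assoc, ← mul_assoc, hU, lambdaMat_mul_self]
  calc ∑ a, sstar v (U (partner a)) • U a
      = (v ᵥ* (lambdaMat N * Uᵀ * lambdaMat N)) ᵥ* U := by
        rw [Matrix.vecMul_eq_sum]
        refine Finset.sum_congr rfl fun a _ => ?_
        congr 1
        rw [← Matrix.vecMul_vecMul, vecMul_lambdaMat, ← Matrix.vecMul_vecMul]
        rfl
    _ = v := by rw [Matrix.vecMul_vecMul, hinv, Matrix.vecMul_one]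

/-- `sstar` as a linear functional of its first argument. -/
def sstarLeft {N : ℕ} (w : Fin (2 * N) → ZMod 2) : (Fin (2 * N) → ZMod 2) →ₗ[ZMod 2] ZMod 2 where
  toFun v := sstar v w
  map_add' x y := by simp [sstar, Matrix.add_vecMul, add_dotProduct]
  map_smul' c x := by simp [sstar, Matrix.smul_vecMul, smul_dotProduct]

/-- The symplectic complement of a set of rows of a symplectic matrix is spanned by the rows whose
partner does not belong to the set. -/
lemma mem_span_rows_iff {N : ℕ} {U : Matrix (Fin (2 * N)) (Fin (2 * N)) (ZMod 2)}
    (hU : IsSymplectic U) (T : Set (Fin (2 * N))) (v : Fin (2 * N) → ZMod 2) :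
    v ∈ Submodule.span (ZMod 2) (U.row '' {a | partner a ∉ T}) ↔ ∀ b ∈ T, sstar v (U b) = 0 := by
  constructor
  · intro hv b hb
    suffices h : Submodule.span (ZMod 2) (U.row '' {a | partner a ∉ T}) ≤
        LinearMap.ker (sstarLeft (U b)) from h hv
    rw [Submodule.span_le]
    rintro _ ⟨a, ha, rfl⟩
    have hab : a ≠ partner b := by
      rintro rfl
      exact ha (by rwa [partner_partner])
    exact (sstar_row_row hU a b).trans (if_neg hab)
  · intro h
    rw [← sum_sstar_smul_row hU v]
    refine Submodule.sum_mem _ fun a _ => ?_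
    by_cases ha : partner a ∈ T
    · rw [h _ ha, zero_smul]
      exact Submodule.zero_mem _
    · exact Submodule.smul_mem _ _ (Submodule.subset_span ⟨a, ha, rfl⟩)

lemma forall_muRow_iff {n m : ℕ} {U : Matrix (Fin (2 * (n + m))) (Fin (2 * (n + m))) (ZMod 2)}
    {p : (Fin (2 * (n + m)) → ZMod 2) → Prop} :
    (∀ i, p (muRow n m U i)) ↔ ∀ b : Fin (2 * (n + m)), b.val < 2 * m → p (U b) :=
  ⟨fun h b hb => h ⟨b, hb⟩, fun h i => h _ i.isLt⟩

lemma forall_lamRow_iff {n k m : ℕ} {hk : k ≤ n}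
    {U : Matrix (Fin (2 * (n + m))) (Fin (2 * (n + m))) (ZMod 2)}
    {p : (Fin (2 * (n + m)) → ZMod 2) → Prop} :
    (∀ i, p (lamRow n k m hk U i)) ↔
      ∀ b : Fin (2 * (n + m)), 2 * m ≤ b.val → b.val < 2 * m + 2 * k → p (U b) := by
  constructor
  · intro h b hb hb'
    have hrow : lamRow n k m hk U ⟨b - 2 * m, by omega⟩ = U b :=
      congrArg U (Fin.ext (by simp only; omega))
    exact hrow ▸ h _
  · exact fun h i => h _ (Nat.le_add_right _ _) (by have := i.isLt; simp only; omega)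

lemma forall_sigRow_iff {n k m : ℕ}
    {U : Matrix (Fin (2 * (n + m))) (Fin (2 * (n + m))) (ZMod 2)}
    {p : (Fin (2 * (n + m)) → ZMod 2) → Prop} :
    (∀ i, p (sigRow n k m U i)) ↔
      ∀ b : Fin (2 * (n + m)), 2 * m + 2 * k ≤ b.val → b.val % 2 = 1 → p (U b) := by
  constructor
  · intro h b hb hb'
    have := b.isLt
    have hrow : sigRow n k m U ⟨(b - 2 * m - 2 * k) / 2, by omega⟩ = U b :=
      congrArg U (Fin.ext (by simp only; omega))
    exact hrow ▸ h _
  · exact fun h i => h _ (by simp only; omega) (by simp only; omega)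

lemma range_lamRow (n k m : ℕ) (hk : k ≤ n)
    (U : Matrix (Fin (2 * (n + m))) (Fin (2 * (n + m))) (ZMod 2)) :
    Set.range (lamRow n k m hk U) = U.row '' {a | 2 * m ≤ a.val ∧ a.val < 2 * m + 2 * k} := by
  apply Set.Subset.antisymm
  · rw [Set.range_subset_iff, forall_lamRow_iff]
    exact fun b hb hb' => ⟨b, ⟨hb, hb'⟩, rfl⟩
  · rintro _ ⟨a, ⟨ha, ha'⟩, rfl⟩
    exact forall_lamRow_iff (p := (· ∈ Set.range (lamRow n k m hk U))).1
      Set.mem_range_self a ha ha'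

lemma range_sigRow (n k m : ℕ)
    (U : Matrix (Fin (2 * (n + m))) (Fin (2 * (n + m))) (ZMod 2)) :
    Set.range (sigRow n k m U) = U.row '' {a | 2 * m + 2 * k ≤ a.val ∧ a.val % 2 = 1} := by
  apply Set.Subset.antisymm
  · rw [Set.range_subset_iff, forall_sigRow_iff]
    exact fun b hb hb' => ⟨b, ⟨hb, hb'⟩, rfl⟩
  · rintro _ ⟨a, ⟨ha, ha'⟩, rfl⟩
    exact forall_sigRow_iff (p := (· ∈ Set.range (sigRow n k m U))).1
      Set.mem_range_self a ha ha'

/-- the subspace of F_2^{2(n+m)} orthogonal (for the symplectic product) to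
every row of U_eff is exactly the row space of [Σ_P Σ_M]; and the subspace orthogonal to
every row of [μ_P μ_M] and of [Σ_P Σ_M] is exactly the span of the rows of [Λ_P Λ_M]
together with the rows of [Σ_P Σ_M]. -/
theorem stmt_9 (n k m : ℕ) (hn : 1 ≤ n) (hk : k ≤ n) (hm : 1 ≤ m)
    (U : Matrix (Fin (2 * (n + m))) (Fin (2 * (n + m))) (ZMod 2))
    (hU : IsSymplectic U) :
    ({v : Fin (2 * (n + m)) → ZMod 2 |
        (∀ i : Fin (2 * m), sstar v (muRow n m U i) = 0) ∧
        (∀ i : Fin (2 * k), sstar v (lamRow n k m hk U i) = 0) ∧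
        (∀ i : Fin (n - k), sstar v (sigRow n k m U i) = 0)}
      = ↑(Submodule.span (ZMod 2) (Set.range (sigRow n k m U)))) ∧
    ({v : Fin (2 * (n + m)) → ZMod 2 |
        (∀ i : Fin (2 * m), sstar v (muRow n m U i) = 0) ∧
        (∀ i : Fin (n - k), sstar v (sigRow n k m U i) = 0)}
      = ↑(Submodule.span (ZMod 2)
          (Set.range (lamRow n k m hk U) ∪ Set.range (sigRow n k m U)))) := by
  constructor
  · have hT : {a : Fin (2 * (n + m)) | 2 * m + 2 * k ≤ a.val ∧ a.val % 2 = 1} =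
        {a | partner a ∉ {b : Fin (2 * (n + m)) |
          b.val < 2 * m + 2 * k ∨ 2 * m + 2 * k ≤ b.val ∧ b.val % 2 = 1}} := by
      ext a
      simp only [Set.mem_ofPred_eq, partner_val]
      split_ifs <;> omega
    ext v
    rw [range_sigRow, hT, SetLike.mem_coe, mem_span_rows_iff hU, Set.mem_ofPred_eq,
      forall_muRow_iff (p := (sstar v · = 0)), forall_lamRow_iff (p := (sstar v · = 0)),
      forall_sigRow_iff (p := (sstar v · = 0))]
    constructor
    · rintro ⟨hmu, hlam, hsig⟩ b (hb | ⟨hb, hb'⟩)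
      · exact (lt_or_ge b.val (2 * m)).elim (hmu b) fun hb' => hlam b hb' hb
      · exact hsig b hb hb'
    · exact fun h => ⟨fun b hb => h b (Or.inl (by omega)), fun b _ hb => h b (Or.inl hb),
        fun b hb hb' => h b (Or.inr ⟨hb, hb'⟩)⟩
  · have hT : {a : Fin (2 * (n + m)) | 2 * m ≤ a.val ∧ a.val < 2 * m + 2 * k} ∪
          {a | 2 * m + 2 * k ≤ a.val ∧ a.val % 2 = 1} =
        {a | partner a ∉ {b : Fin (2 * (n + m)) |
          b.val < 2 * m ∨ 2 * m + 2 * k ≤ b.val ∧ b.val % 2 = 1}} := by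
      ext a
      simp only [Set.mem_union, Set.mem_ofPred_eq, partner_val]
      split_ifs <;> omega
    ext v
    rw [range_lamRow, range_sigRow, ← Set.image_union, hT, SetLike.mem_coe,
      mem_span_rows_iff hU, Set.mem_ofPred_eq, forall_muRow_iff (p := (sstar v · = 0)),
      forall_sigRow_iff (p := (sstar v · = 0))]
    constructor
    · rintro ⟨hmu, hsig⟩ b (hb | ⟨hb, hb'⟩)
      · exact hmu b hb
      · exact hsig b hb hb'
    · exact fun h => ⟨fun b hb => h b (Or.inl hb), fun b hb hb' => h b (Or.inr ⟨hb, hb'⟩)⟩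
end

section
/- Let U be a seed transformation with blocks as above. Suppose M, M′ ∈ F_2^{2m}, L ∈ F_2^{2k}, and S ∈ F_2^{n−k} satisfy (M:L:S) U_eff = (0_{2n} : M′). Then for every T ∈ F_2^{2m}, M′ ⋆ (T μ_M) = M ⋆ T, where ⋆ is the Λ_m-symplectic product on F_2^{2m}. -/
open Matrix

/-- The block μ_P of a seed transformation: rows 1..2m, first 2n columns. -/
def muP (n m : ℕ) (U : Matrix (Fin (2 * (n + m))) (Fin (2 * (n + m))) (ZMod 2)) :
    Matrix (Fin (2 * m)) (Fin (2 * n)) (ZMod 2) :=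
  Matrix.of fun i j =>
    U ⟨i.val, by have := i.isLt; omega⟩ ⟨j.val, by have := j.isLt; omega⟩

/-- The block μ_M of a seed transformation: rows 1..2m, last 2m columns. -/
def muM (n m : ℕ) (U : Matrix (Fin (2 * (n + m))) (Fin (2 * (n + m))) (ZMod 2)) :
    Matrix (Fin (2 * m)) (Fin (2 * m)) (ZMod 2) :=
  Matrix.of fun i j =>
    U ⟨i.val, by have := i.isLt; omega⟩ ⟨2 * n + j.val, by have := j.isLt; omega⟩

/-- The block Λ_P of a seed transformation: rows 2m+1..2m+2k, first 2n columns. -/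
def lamP (n k m : ℕ) (hk : k ≤ n)
    (U : Matrix (Fin (2 * (n + m))) (Fin (2 * (n + m))) (ZMod 2)) :
    Matrix (Fin (2 * k)) (Fin (2 * n)) (ZMod 2) :=
  Matrix.of fun i j =>
    U ⟨2 * m + i.val, by have := i.isLt; omega⟩ ⟨j.val, by have := j.isLt; omega⟩

/-- The block Λ_M of a seed transformation: rows 2m+1..2m+2k, last 2m columns. -/
def lamM (n k m : ℕ) (hk : k ≤ n)
    (U : Matrix (Fin (2 * (n + m))) (Fin (2 * (n + m))) (ZMod 2)) :
    Matrix (Fin (2 * k)) (Fin (2 * m)) (ZMod 2) :=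
  Matrix.of fun i j =>
    U ⟨2 * m + i.val, by have := i.isLt; omega⟩ ⟨2 * n + j.val, by have := j.isLt; omega⟩

/-- The block Σ_P of a seed transformation: rows of index 2m+2k+2i (1-indexed,
i = 1,…,n−k), first 2n columns. -/
def sigP (n k m : ℕ)
    (U : Matrix (Fin (2 * (n + m))) (Fin (2 * (n + m))) (ZMod 2)) :
    Matrix (Fin (n - k)) (Fin (2 * n)) (ZMod 2) :=
  Matrix.of fun i j =>
    U ⟨2 * m + 2 * k + 2 * i.val + 1, by have := i.isLt; omega⟩
      ⟨j.val, by have := j.isLt; omega⟩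

/-- The block Σ_M of a seed transformation: rows of index 2m+2k+2i (1-indexed,
i = 1,…,n−k), last 2m columns. -/
def sigM (n k m : ℕ)
    (U : Matrix (Fin (2 * (n + m))) (Fin (2 * (n + m))) (ZMod 2)) :
    Matrix (Fin (n - k)) (Fin (2 * m)) (ZMod 2) :=
  Matrix.of fun i j =>
    U ⟨2 * m + 2 * k + 2 * i.val + 1, by have := i.isLt; omega⟩
      ⟨2 * n + j.val, by have := j.isLt; omega⟩


/-- The symplectic form splits along the decomposition `F_2^{2(n+m)} = F_2^{2n} × F_2^{2m}`. -/
theorem sstar_eq_add (n m : ℕ) (X Y : Fin (2 * (n + m)) → ZMod 2) :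
    sstar X Y =
      sstar (fun j : Fin (2 * n) => X ⟨j.val, by have := j.isLt; omega⟩)
          (fun j : Fin (2 * n) => Y ⟨j.val, by have := j.isLt; omega⟩) +
        sstar (fun j : Fin (2 * m) => X ⟨2 * n + j.val, by have := j.isLt; omega⟩)
          (fun j : Fin (2 * m) => Y ⟨2 * n + j.val, by have := j.isLt; omega⟩) := by
  have hl (j : Fin (2 * n)) : j.val < 2 * (n + m) := by have := j.isLt; omega
  have hr (j : Fin (2 * m)) : 2 * n + j.val < 2 * (n + m) := by have := j.isLt; omega
  have hsum (f : Fin (2 * (n + m)) → ZMod 2) :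
      ∑ j, f j = ∑ j : Fin (2 * n), f ⟨j.val, hl j⟩ +
        ∑ j : Fin (2 * m), f ⟨2 * n + j.val, hr j⟩ := by
    have h : 2 * n + 2 * m = 2 * (n + m) := by ring
    rw [← Equiv.sum_comp (finCongr h) f, Fin.sum_univ_add]
    rfl
  have hdiag (i j : ℕ) : ((2 * n + i) / 2 = (2 * n + j) / 2) ↔ i / 2 = j / 2 := by omega
  have hlower (i : Fin (2 * m)) (j : Fin (2 * n)) : (2 * n + i.val) / 2 ≠ j.val / 2 := by
    have := j.isLt
    omega
  have hupper (i : Fin (2 * n)) (j : Fin (2 * m)) : i.val / 2 ≠ (2 * n + j.val) / 2 :=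
    (hlower j i).symm
  simp only [sstar, dotProduct, vecMul, hsum]
  simp [lambdaMat, hdiag, hlower, hupper, Fin.ext_iff]

/-- A symplectic matrix preserves the symplectic form. -/
theorem IsSymplectic.sstar_vecMul {N : ℕ} {U : Matrix (Fin (2 * N)) (Fin (2 * N)) (ZMod 2)}
    (hU : IsSymplectic U) (X Y : Fin (2 * N) → ZMod 2) :
    sstar (X ᵥ* U) (Y ᵥ* U) = sstar X Y := by
  unfold sstar
  rw [← mulVec_transpose U Y, dotProduct_mulVec, vecMul_vecMul, vecMul_vecMul, ← Matrix.mul_assoc,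
    show U * lambdaMat N * Uᵀ = lambdaMat N from hU]

/-- The rows of `A.submatrix r c` are combined by first extending the coefficients by zero
along `r`. -/
theorem vecMul_submatrix_eq {ι κ l o R : Type*} [Fintype ι] [Fintype κ] [DecidableEq κ]
    [CommSemiring R] (v : ι → R) (A : Matrix κ l R) (r : ι → κ) (c : o → l) :
    v ᵥ* A.submatrix r c = (v ᵥ* (1 : Matrix κ κ R).submatrix r id ᵥ* A) ∘ c := by
  have h : (1 : Matrix κ κ R).submatrix r id * A = A.submatrix r id := by
    ext i j
    simp [Matrix.mul_apply, Matrix.one_apply]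
  rw [vecMul_vecMul, h]
  rfl

/-- The symplectic product of two vectors extended by zero along `r` and `q` only involves the
corresponding submatrix of the form. -/
theorem sstar_vecMul_one_submatrix {N : ℕ} {ι κ : Type*} [Fintype ι] [Fintype κ]
    (v : ι → ZMod 2) (w : κ → ZMod 2) (r : ι → Fin (2 * N)) (q : κ → Fin (2 * N)) :
    sstar (v ᵥ* (1 : Matrix (Fin (2 * N)) (Fin (2 * N)) (ZMod 2)).submatrix r id)
        (w ᵥ* (1 : Matrix (Fin (2 * N)) (Fin (2 * N)) (ZMod 2)).submatrix q id) =
      v ᵥ* (lambdaMat N).submatrix r q ⬝ᵥ w := by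
  unfold sstar
  rw [← mulVec_transpose _ w, dotProduct_mulVec, vecMul_submatrix_eq v (lambdaMat N) r q]
  congr 1
  ext j
  simp [-vecMul_vecMul, vecMul, dotProduct, Matrix.one_apply]

theorem sstar_add_left {N : ℕ} (X Y Z : Fin (2 * N) → ZMod 2) :
    sstar (X + Y) Z = sstar X Z + sstar Y Z := by
  simp [sstar, add_vecMul]

/-- if (M:L:S) U_eff = (0_{2n} : M′) then for every T ∈ F_2^{2m},
M′ ⋆ (T μ_M) = M ⋆ T. -/
theorem stmt_11 (n k m : ℕ) (hn : 1 ≤ n) (hk : k ≤ n) (hm : 1 ≤ m)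
    (U : Matrix (Fin (2 * (n + m))) (Fin (2 * (n + m))) (ZMod 2))
    (hU : IsSymplectic U)
    (M M' : Fin (2 * m) → ZMod 2) (L : Fin (2 * k) → ZMod 2)
    (S : Fin (n - k) → ZMod 2)
    (hP : Matrix.vecMul M (muP n m U) + Matrix.vecMul L (lamP n k m hk U)
        + Matrix.vecMul S (sigP n k m U) = 0)
    (hM : Matrix.vecMul M (muM n m U) + Matrix.vecMul L (lamM n k m hk U)
        + Matrix.vecMul S (sigM n k m U) = M') :
    ∀ T : Fin (2 * m) → ZMod 2,
      sstar M' (Matrix.vecMul T (muM n m U)) = sstar M T := by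
  intro T
  let rM : Fin (2 * m) → Fin (2 * (n + m)) := fun i => ⟨i.val, by have := i.isLt; omega⟩
  let rL : Fin (2 * k) → Fin (2 * (n + m)) := fun i => ⟨2 * m + i.val, by have := i.isLt; omega⟩
  let rS : Fin (n - k) → Fin (2 * (n + m)) := fun i =>
    ⟨2 * m + 2 * k + 2 * i.val + 1, by have := i.isLt; omega⟩
  let cP : Fin (2 * n) → Fin (2 * (n + m)) := fun j => ⟨j.val, by have := j.isLt; omega⟩
  let cM : Fin (2 * m) → Fin (2 * (n + m)) := fun j => ⟨2 * n + j.val, by have := j.isLt; omega⟩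
  let I : Matrix (Fin (2 * (n + m))) (Fin (2 * (n + m))) (ZMod 2) := 1
  let V := M ᵥ* I.submatrix rM id + L ᵥ* I.submatrix rL id + S ᵥ* I.submatrix rS id
  let W := T ᵥ* I.submatrix rM id
  have hVP : (V ᵥ* U) ∘ cP = 0 := by
    rw [← hP, show muP n m U = U.submatrix rM cP from rfl,
      show lamP n k m hk U = U.submatrix rL cP from rfl,
      show sigP n k m U = U.submatrix rS cP from rfl,
      vecMul_submatrix_eq M U, vecMul_submatrix_eq L U, vecMul_submatrix_eq S U]
    simp only [V, add_vecMul]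
    rfl
  have hVM : (V ᵥ* U) ∘ cM = M' := by
    rw [← hM, show muM n m U = U.submatrix rM cM from rfl,
      show lamM n k m hk U = U.submatrix rL cM from rfl,
      show sigM n k m U = U.submatrix rS cM from rfl,
      vecMul_submatrix_eq M U, vecMul_submatrix_eq L U, vecMul_submatrix_eq S U]
    simp only [V, add_vecMul]
    rfl
  have hWM : (W ᵥ* U) ∘ cM = T ᵥ* muM n m U := (vecMul_submatrix_eq T U rM cM).symm
  have hMM : (lambdaMat (n + m)).submatrix rM rM = lambdaMat m := by
    ext i j
    simp [lambdaMat, rM, Fin.ext_iff]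
  have hLM : (lambdaMat (n + m)).submatrix rL rM = 0 := by
    ext i j
    have h : (2 * m + i.val) / 2 ≠ j.val / 2 := by omega
    simp [lambdaMat, rL, rM, h]
  have hSM : (lambdaMat (n + m)).submatrix rS rM = 0 := by
    ext i j
    have h : (2 * m + 2 * k + 2 * i.val + 1) / 2 ≠ j.val / 2 := by omega
    simp [lambdaMat, rS, rM, h]
  calc
    sstar M' (T ᵥ* muM n m U) =
        sstar ((V ᵥ* U) ∘ cP) ((W ᵥ* U) ∘ cP) + sstar ((V ᵥ* U) ∘ cM) ((W ᵥ* U) ∘ cM) := by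
      rw [hVP, hVM, hWM]
      simp [sstar]
    _ = sstar (V ᵥ* U) (W ᵥ* U) := (sstar_eq_add n m _ _).symm
    _ = sstar V W := hU.sstar_vecMul V W
    _ = sstar M T := by
      simp only [V, W, I, sstar_add_left, sstar_vecMul_one_submatrix, hMM, hLM, hSM, vecMul_zero,
        zero_dotProduct, add_zero]
      rfl
end

section
/- Let U be a seed transformation with blocks as above; let 𝔰 be the row space of Σ_M, 𝔰₀ = Σ_{i≥0} 𝔰 μ_M^i, 𝒩₀ = Σ_{t≥1} {M ∈ F_2^{2m} : M μ_M^t = 0}, and 𝒱₀ = 𝔰₀ + 𝒩₀. Then the kernel graph has constant in-degree 1 and positive out-degree: (a) for every M′ ∈ 𝒱₀^⊥ there exists exactly one M ∈ 𝒱₀^⊥ for which there exist L ∈ F_2^{2k} and S ∈ F_2^{n−k} with (M:L:S) U_eff = (0_{2n} : M′); and (b) for every M ∈ 𝒱₀^⊥ there exist M′ ∈ 𝒱₀^⊥, L ∈ F_2^{2k}, and S ∈ F_2^{n−k} with (M:L:S) U_eff = (0_{2n} : M′). -/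
open Matrix

/-- (M:L:S) U_eff = (0_{2n} : M′): an edge of physical weight 0 (with syndrome input S)
from M to M′ with logical label L in the state diagram of the seed transformation U. -/
def ZeroPhysEdge (n k m : ℕ) (hk : k ≤ n)
    (U : Matrix (Fin (2 * (n + m))) (Fin (2 * (n + m))) (ZMod 2))
    (M : Fin (2 * m) → ZMod 2) (L : Fin (2 * k) → ZMod 2)
    (S : Fin (n - k) → ZMod 2) (M' : Fin (2 * m) → ZMod 2) : Prop :=
  Matrix.vecMul M (muP n m U) + Matrix.vecMul L (lamP n k m hk U)
      + Matrix.vecMul S (sigP n k m U) = 0 ∧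
  Matrix.vecMul M (muM n m U) + Matrix.vecMul L (lamM n k m hk U)
      + Matrix.vecMul S (sigM n k m U) = M'

/-- The orthogonal complement of a subspace W ⊆ F_2^{2m} under the symplectic product. -/
def sperp (m : ℕ) (W : Submodule (ZMod 2) (Fin (2 * m) → ZMod 2)) :
    Set (Fin (2 * m) → ZMod 2) :=
  {M | ∀ T ∈ W, sstar M T = 0}

/-- The row space 𝔰 of Σ_M. -/
def sSpace (n k m : ℕ) (U : Matrix (Fin (2 * (n + m))) (Fin (2 * (n + m))) (ZMod 2)) :
    Submodule (ZMod 2) (Fin (2 * m) → ZMod 2) :=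
  Submodule.span (ZMod 2) (Set.range fun l => sigM n k m U l)

/-- 𝔰₀ = Σ_{i≥0} 𝔰 μ_M^i, the smallest μ_M-invariant subspace containing 𝔰. -/
def sZero (n k m : ℕ) (U : Matrix (Fin (2 * (n + m))) (Fin (2 * (n + m))) (ZMod 2)) :
    Submodule (ZMod 2) (Fin (2 * m) → ZMod 2) :=
  ⨆ i : ℕ, Submodule.map ((muM n m U) ^ i).vecMulLinear (sSpace n k m U)

/-- 𝒩₀ = Σ_{t≥1} Null(μ_M^t), the union of the left null spaces of positive powers of μ_M. -/
def nZero (n m : ℕ) (U : Matrix (Fin (2 * (n + m))) (Fin (2 * (n + m))) (ZMod 2)) :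
    Submodule (ZMod 2) (Fin (2 * m) → ZMod 2) :=
  ⨆ t : ℕ, LinearMap.ker ((muM n m U) ^ (t + 1)).vecMulLinear

/-- 𝒱₀ = 𝔰₀ + 𝒩₀.  The kernel graph of U is the directed graph on vertex set 𝒱₀^⊥ whose
edges are the physical-weight-0 edges of the state diagram. -/
def vZero (n k m : ℕ) (U : Matrix (Fin (2 * (n + m))) (Fin (2 * (n + m))) (ZMod 2)) :
    Submodule (ZMod 2) (Fin (2 * m) → ZMod 2) :=
  sZero n k m U ⊔ nZero n m U

/-- The involution of `Fin (2 * N)` exchanging the two indices of each 2×2 diagonal block. -/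
def blockSwap {N : ℕ} (j : Fin (2 * N)) : Fin (2 * N) :=
  ⟨if j.val % 2 = 0 then j.val + 1 else j.val - 1, by have := j.isLt; split_ifs <;> omega⟩

lemma blockSwap_blockSwap {N : ℕ} (j : Fin (2 * N)) : blockSwap (blockSwap j) = j := by
  ext
  simp only [blockSwap]
  split_ifs <;> omega

lemma vecMul_lambdaMat_s15 {N : ℕ} (P : Fin (2 * N) → ZMod 2) (j : Fin (2 * N)) :
    Matrix.vecMul P (lambdaMat N) j = P (blockSwap j) := by
  rw [Matrix.vecMul, dotProduct, Finset.sum_eq_single (blockSwap j)]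
  · have h : (blockSwap j).val / 2 = j.val / 2 ∧ blockSwap j ≠ j := by
      rw [Ne, Fin.ext_iff]
      simp only [blockSwap]
      split_ifs <;> omega
    simp [lambdaMat, h]
  · intro b _ hb
    have h : ¬ (b.val / 2 = j.val / 2 ∧ b ≠ j) := by
      rw [Ne, Fin.ext_iff] at hb ⊢
      simp only [blockSwap] at hb
      split_ifs at hb <;> omega
    simp [lambdaMat, h]
  · simp

lemma sstar_eq_sum {N : ℕ} (P Q : Fin (2 * N) → ZMod 2) :
    sstar P Q = ∑ j, P (blockSwap j) * Q j := by
  simp only [sstar, dotProduct, vecMul_lambdaMat_s15]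

lemma eq_zero_of_sstar_eq_zero {N : ℕ} {P : Fin (2 * N) → ZMod 2}
    (h : ∀ Q, sstar P Q = 0) : P = 0 := by
  ext j
  have := h (Pi.single (blockSwap j) 1)
  rwa [sstar, dotProduct_single_one, vecMul_lambdaMat_s15, blockSwap_blockSwap] at this

lemma sstar_sub_left {N : ℕ} (P P' Q : Fin (2 * N) → ZMod 2) :
    sstar (P - P') Q = sstar P Q - sstar P' Q := by
  simp only [sstar, Matrix.sub_vecMul, sub_dotProduct]

lemma sstar_add_right {N : ℕ} (P Q Q' : Fin (2 * N) → ZMod 2) :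
    sstar P (Q + Q') = sstar P Q + sstar P Q' := by
  simp only [sstar, dotProduct_add]

/-- The adjoint of a matrix with respect to the symplectic product. -/
def symplecticAdjoint {N : ℕ} (A : Matrix (Fin (2 * N)) (Fin (2 * N)) (ZMod 2)) :
    Matrix (Fin (2 * N)) (Fin (2 * N)) (ZMod 2) :=
  lambdaMat N * Aᵀ * lambdaMat N

lemma vecMul_symplecticAdjoint_apply {N : ℕ}
    (A : Matrix (Fin (2 * N)) (Fin (2 * N)) (ZMod 2)) (P : Fin (2 * N) → ZMod 2)
    (i : Fin (2 * N)) :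
    Matrix.vecMul P (symplecticAdjoint A) i = sstar P (A (blockSwap i)) := by
  rw [symplecticAdjoint, ← Matrix.vecMul_vecMul, vecMul_lambdaMat_s15, ← Matrix.vecMul_vecMul]
  rfl

lemma sstar_vecMul_symplecticAdjoint {N : ℕ}
    (A : Matrix (Fin (2 * N)) (Fin (2 * N)) (ZMod 2)) (P Q : Fin (2 * N) → ZMod 2) :
    sstar (Matrix.vecMul P (symplecticAdjoint A)) Q = sstar P (Matrix.vecMul Q A) := by
  rw [sstar, sstar, symplecticAdjoint, Matrix.vecMul_vecMul, Matrix.mul_assoc,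
    lambdaMat_mul_self, Matrix.mul_one, ← Matrix.vecMul_vecMul, Matrix.vecMul_transpose,
    dotProduct_comm, Matrix.dotProduct_mulVec, dotProduct_comm]

lemma IsSymplectic.vecMul_eq_iff {N : ℕ}
    {U : Matrix (Fin (2 * N)) (Fin (2 * N)) (ZMod 2)} (hU : IsSymplectic U)
    (X Y : Fin (2 * N) → ZMod 2) :
    Matrix.vecMul X U = Y ↔ X = Matrix.vecMul Y (symplecticAdjoint U) := by
  have h : U * symplecticAdjoint U = 1 := by
    rw [symplecticAdjoint, ← Matrix.mul_assoc, ← Matrix.mul_assoc, hU, lambdaMat_mul_self]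
  have h' : symplecticAdjoint U * U = 1 := mul_eq_one_comm.mp h
  constructor
  · rintro rfl
    rw [Matrix.vecMul_vecMul, h, Matrix.vecMul_one]
  · rintro rfl
    rw [Matrix.vecMul_vecMul, h', Matrix.vecMul_one]

lemma sum_range_two_mul {R : Type*} [AddCommMonoid R] (G : ℕ → R) (b : ℕ) :
    ∑ i ∈ Finset.range (2 * b), G i =
      ∑ i ∈ Finset.range b, G (2 * i) + ∑ i ∈ Finset.range b, G (2 * i + 1) := by
  induction b with
  | zero => simp
  | succ b ih =>
    rw [Nat.mul_succ, Finset.sum_range_succ, Finset.sum_range_succ, ih, Finset.sum_range_succ,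
      Finset.sum_range_succ]
    abel

/-- Splitting a sum over the rows of a seed transformation into memory, logical, and the two
halves of the syndrome rows. -/
lemma sum_rows {R : Type*} [AddCommMonoid R] {n k m : ℕ} (hk : k ≤ n)
    (g : Fin (2 * (n + m)) → R) :
    ∑ i, g i = ∑ i : Fin (2 * m), g ⟨i.val, by have := i.isLt; omega⟩
      + ∑ i : Fin (2 * k), g ⟨2 * m + i.val, by have := i.isLt; omega⟩
      + (∑ i : Fin (n - k), g ⟨2 * m + 2 * k + 2 * i.val, by have := i.isLt; omega⟩
      + ∑ i : Fin (n - k), g ⟨2 * m + 2 * k + 2 * i.val + 1, by have := i.isLt; omega⟩) := by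
  let G : ℕ → R := fun i => if h : i < 2 * (n + m) then g ⟨i, h⟩ else 0
  have hG : ∀ i (h : i < 2 * (n + m)), g ⟨i, h⟩ = G i := fun i h => by simp [G, h]
  have h0 : ∑ i, g i = ∑ i ∈ Finset.range (2 * m + 2 * k + 2 * (n - k)), G i := by
    rw [show 2 * m + 2 * k + 2 * (n - k) = 2 * (n + m) by omega, Finset.sum_range]
    exact Finset.sum_congr rfl fun i _ => hG i i.isLt
  rw [h0, Finset.sum_range_add, Finset.sum_range_add,
    sum_range_two_mul (fun i => G (2 * m + 2 * k + i))]
  simp only [hG, Finset.sum_range, add_assoc]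

/-- Splitting a sum over the columns of a seed transformation into physical and memory. -/
lemma sum_cols {R : Type*} [AddCommMonoid R] {n m : ℕ} (g : Fin (2 * (n + m)) → R) :
    ∑ i, g i = ∑ i : Fin (2 * n), g ⟨i.val, by have := i.isLt; omega⟩
      + ∑ i : Fin (2 * m), g ⟨2 * n + i.val, by have := i.isLt; omega⟩ := by
  let G : ℕ → R := fun i => if h : i < 2 * (n + m) then g ⟨i, h⟩ else 0
  have hG : ∀ i (h : i < 2 * (n + m)), g ⟨i, h⟩ = G i := fun i h => by simp [G, h]
  have h0 : ∑ i, g i = ∑ i ∈ Finset.range (2 * n + 2 * m), G i := by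
    rw [show 2 * n + 2 * m = 2 * (n + m) by omega, Finset.sum_range]
    exact Finset.sum_congr rfl fun i _ => hG i i.isLt
  rw [h0, Finset.sum_range_add]
  simp only [hG, Finset.sum_range]

/-- The row vector (0_{2n} : M′). -/
def zeroPhys (n : ℕ) {m : ℕ} (M' : Fin (2 * m) → ZMod 2) : Fin (2 * (n + m)) → ZMod 2 :=
  fun j => if h : 2 * n ≤ j.val then M' ⟨j.val - 2 * n, by have := j.isLt; omega⟩ else 0

/-- The memory part of a row vector (P : M′). -/
def memPart (n : ℕ) {m : ℕ} (W : Fin (2 * (n + m)) → ZMod 2) : Fin (2 * m) → ZMod 2 :=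
  fun j => W ⟨2 * n + j.val, by have := j.isLt; omega⟩

lemma sstar_zeroPhys {n m : ℕ} (M' : Fin (2 * m) → ZMod 2)
    (W : Fin (2 * (n + m)) → ZMod 2) :
    sstar (zeroPhys n M') W = sstar M' (memPart n W) := by
  rw [sstar_eq_sum, sstar_eq_sum, sum_cols, Finset.sum_eq_zero, zero_add]
  · refine Finset.sum_congr rfl fun j _ => ?_
    have h : 2 * n ≤ (blockSwap (⟨2 * n + j.val, by have := j.isLt; omega⟩ :
        Fin (2 * (n + m)))).val := by
      simp only [blockSwap]; split_ifs <;> omega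
    rw [zeroPhys, dif_pos h, memPart]
    congr 2
    ext
    simp only [blockSwap]
    split_ifs <;> omega
  · intro j _
    have h : ¬ 2 * n ≤ (blockSwap (⟨j.val, by have := j.isLt; omega⟩ :
        Fin (2 * (n + m)))).val := by
      have := j.isLt
      simp only [blockSwap]; split_ifs <;> omega
    rw [zeroPhys, dif_neg h, zero_mul]

/-- The input row vector (M : L : S), with S placed on the stabilizer rows used by U_eff. -/
def effInput {n k m : ℕ} (M : Fin (2 * m) → ZMod 2) (L : Fin (2 * k) → ZMod 2)
    (S : Fin (n - k) → ZMod 2) : Fin (2 * (n + m)) → ZMod 2 :=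
  fun r =>
    if h : r.val < 2 * m then M ⟨r.val, h⟩
    else if h' : r.val < 2 * m + 2 * k then L ⟨r.val - 2 * m, by omega⟩
    else if (r.val - 2 * m - 2 * k) % 2 = 1 then
      S ⟨(r.val - 2 * m - 2 * k) / 2, by have := r.isLt; omega⟩
    else 0

section effInput

variable {n k m : ℕ} (M : Fin (2 * m) → ZMod 2) (L : Fin (2 * k) → ZMod 2)
  (S : Fin (n - k) → ZMod 2)

lemma effInput_mem (i : Fin (2 * m)) (h : i.val < 2 * (n + m)) :
    effInput M L S ⟨i.val, h⟩ = M i := by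
  simp [effInput]

lemma effInput_log (i : Fin (2 * k)) (h : 2 * m + i.val < 2 * (n + m)) :
    effInput M L S ⟨2 * m + i.val, h⟩ = L i := by
  simp [effInput]

lemma effInput_even (i : Fin (n - k)) (h : 2 * m + 2 * k + 2 * i.val < 2 * (n + m)) :
    effInput M L S ⟨2 * m + 2 * k + 2 * i.val, h⟩ = 0 := by
  have h1 : ¬ 2 * m + 2 * k + 2 * i.val < 2 * m := by omega
  have h2 : ¬ 2 * m + 2 * k + 2 * i.val < 2 * m + 2 * k := by omega
  have h3 : ¬ (2 * m + 2 * k + 2 * i.val - 2 * m - 2 * k) % 2 = 1 := by omega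
  simp only [effInput, h1, h2, h3, dite_false, if_false]

lemma effInput_odd (i : Fin (n - k)) (h : 2 * m + 2 * k + 2 * i.val + 1 < 2 * (n + m)) :
    effInput M L S ⟨2 * m + 2 * k + 2 * i.val + 1, h⟩ = S i := by
  have h1 : ¬ 2 * m + 2 * k + 2 * i.val + 1 < 2 * m := by omega
  have h2 : ¬ 2 * m + 2 * k + 2 * i.val + 1 < 2 * m + 2 * k := by omega
  have h3 : (2 * m + 2 * k + 2 * i.val + 1 - 2 * m - 2 * k) % 2 = 1 := by omega
  have h4 : (2 * m + 2 * k + 2 * i.val + 1 - 2 * m - 2 * k) / 2 = i.val := by omega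
  simp only [effInput, h1, h2, h3, h4, dite_false, if_true]

lemma vecMul_effInput (hk : k ≤ n)
    (U : Matrix (Fin (2 * (n + m))) (Fin (2 * (n + m))) (ZMod 2))
    (j : Fin (2 * (n + m))) :
    Matrix.vecMul (effInput M L S) U j =
      ∑ i : Fin (2 * m), M i * U ⟨i.val, by have := i.isLt; omega⟩ j
      + ∑ i : Fin (2 * k), L i * U ⟨2 * m + i.val, by have := i.isLt; omega⟩ j
      + ∑ i : Fin (n - k), S i *
          U ⟨2 * m + 2 * k + 2 * i.val + 1, by have := i.isLt; omega⟩ j := by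
  rw [Matrix.vecMul, dotProduct, sum_rows hk]
  simp only [effInput_mem, effInput_log, effInput_even, effInput_odd, zero_mul,
    Finset.sum_const_zero, zero_add]

lemma zeroPhysEdge_iff_vecMul (hk : k ≤ n)
    (U : Matrix (Fin (2 * (n + m))) (Fin (2 * (n + m))) (ZMod 2))
    (M' : Fin (2 * m) → ZMod 2) :
    ZeroPhysEdge n k m hk U M L S M' ↔
      Matrix.vecMul (effInput M L S) U = zeroPhys n M' := by
  constructor
  · rintro ⟨hP, hM⟩
    ext j
    rw [vecMul_effInput _ _ _ hk]
    by_cases h : 2 * n ≤ j.val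
    · have := congrFun hM ⟨j.val - 2 * n, by have := j.isLt; omega⟩
      have hj : 2 * n + (j.val - 2 * n) = j.val := by omega
      simpa [Matrix.vecMul, dotProduct, muM, lamM, sigM, zeroPhys, h, hj] using this
    · have := congrFun hP ⟨j.val, by omega⟩
      simpa [Matrix.vecMul, dotProduct, muP, lamP, sigP, zeroPhys, h] using this
  · intro hX
    constructor
    · ext j
      have := congrFun hX ⟨j.val, by have := j.isLt; omega⟩
      rw [vecMul_effInput _ _ _ hk, zeroPhys, dif_neg (not_le.mpr j.isLt)] at this
      simpa [Matrix.vecMul, dotProduct, muP, lamP, sigP] using this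
    · ext j
      have := congrFun hX ⟨2 * n + j.val, by have := j.isLt; omega⟩
      rw [vecMul_effInput _ _ _ hk] at this
      simpa [Matrix.vecMul, dotProduct, muM, lamM, sigM, zeroPhys] using this

end effInput

lemma memPart_row_blockSwap {n m : ℕ}
    (U : Matrix (Fin (2 * (n + m))) (Fin (2 * (n + m))) (ZMod 2)) (i : Fin (2 * m)) :
    memPart n (U (blockSwap ⟨i.val, by have := i.isLt; omega⟩)) = muM n m U (blockSwap i) :=
  rfl

/-- A memory state M′ has a predecessor along a physical-weight-0 edge exactly when M′ is
orthogonal to the rows of Σ_M, and then the predecessor is the adjoint image of M′. -/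
lemma exists_zeroPhysEdge_iff {n k m : ℕ} (hk : k ≤ n)
    {U : Matrix (Fin (2 * (n + m))) (Fin (2 * (n + m))) (ZMod 2)} (hU : IsSymplectic U)
    (M M' : Fin (2 * m) → ZMod 2) :
    (∃ (L : Fin (2 * k) → ZMod 2) (S : Fin (n - k) → ZMod 2),
      ZeroPhysEdge n k m hk U M L S M') ↔
      (∀ i, sstar M' (sigM n k m U i) = 0) ∧
        M = Matrix.vecMul M' (symplecticAdjoint (muM n m U)) := by
  have key : ∀ L S, ZeroPhysEdge n k m hk U M L S M' ↔
      ∀ r, effInput M L S r = sstar M' (memPart n (U (blockSwap r))) := by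
    intro L S
    rw [zeroPhysEdge_iff_vecMul, hU.vecMul_eq_iff, funext_iff]
    simp only [vecMul_symplecticAdjoint_apply, sstar_zeroPhys]
  have hswap : ∀ i : Fin (n - k),
      memPart n (U (blockSwap ⟨2 * m + 2 * k + 2 * i.val, by have := i.isLt; omega⟩)) =
        sigM n k m U i := by
    intro i
    ext j
    simp only [memPart, sigM, Matrix.of_apply]
    congr 1
    ext
    simp only [blockSwap]
    split_ifs <;> omega
  simp only [key]
  constructor
  · rintro ⟨L, S, h⟩
    refine ⟨fun i => ?_, ?_⟩
    · rw [← hswap, ← h, effInput_even]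
    · ext i
      rw [vecMul_symplecticAdjoint_apply, ← memPart_row_blockSwap, ← h, effInput_mem]
  · rintro ⟨hs, hM⟩
    let X : Fin (2 * (n + m)) → ZMod 2 := fun r => sstar M' (memPart n (U (blockSwap r)))
    refine ⟨fun i => X ⟨2 * m + i.val, by have := i.isLt; omega⟩,
      fun i => X ⟨2 * m + 2 * k + 2 * i.val + 1, by have := i.isLt; omega⟩, fun r => ?_⟩
    change _ = X r
    obtain ⟨r, hr⟩ := r
    by_cases h1 : r < 2 * m
    · rw [effInput_mem _ _ _ ⟨r, h1⟩, hM, vecMul_symplecticAdjoint_apply,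
        ← memPart_row_blockSwap]
    by_cases h2 : r < 2 * m + 2 * k
    · obtain ⟨a, rfl⟩ := Nat.exists_eq_add_of_le (not_lt.mp h1)
      rw [effInput_log _ _ _ ⟨a, by omega⟩]
    obtain ⟨a, rfl⟩ := Nat.exists_eq_add_of_le (not_lt.mp h2)
    obtain ⟨b, rfl | rfl⟩ := Nat.even_or_odd' a
    · rw [effInput_even _ _ _ ⟨b, by omega⟩]
      exact ((congrArg (sstar M') (hswap ⟨b, by omega⟩)).trans (hs _)).symm
    · exact effInput_odd _ _ _ ⟨b, by omega⟩ _

lemma vecMulLinear_pow {N : ℕ} (A : Matrix (Fin N) (Fin N) (ZMod 2)) (t : ℕ) :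
    (A ^ t).vecMulLinear = A.vecMulLinear ^ t := by
  induction t with
  | zero => ext; simp
  | succ t ih =>
    rw [pow_succ, pow_succ', ← ih]
    ext
    simp [← Matrix.vecMul_vecMul]

lemma vecMul_mem_vZero {n k m : ℕ}
    {U : Matrix (Fin (2 * (n + m))) (Fin (2 * (n + m))) (ZMod 2)}
    {T : Fin (2 * m) → ZMod 2} (hT : T ∈ vZero n k m U) :
    Matrix.vecMul T (muM n m U) ∈ vZero n k m U := by
  suffices h : vZero n k m U ≤ (vZero n k m U).comap (muM n m U).vecMulLinear from h hT
  refine sup_le (iSup_le fun i => ?_) (iSup_le fun t => ?_)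
  · rintro _ ⟨Q, hQ, rfl⟩
    refine le_sup_left (a := sZero n k m U) (Submodule.mem_iSup_of_mem (i + 1) ⟨Q, hQ, ?_⟩)
    simp [pow_succ, Matrix.vecMul_vecMul]
  · intro Q hQ
    refine le_sup_right (b := nZero n m U) (Submodule.mem_iSup_of_mem t ?_)
    simp only [LinearMap.mem_ker, Matrix.vecMulLinear_apply] at hQ ⊢
    rw [Matrix.vecMul_vecMul, ← pow_succ', pow_succ, ← Matrix.vecMul_vecMul, hQ,
      Matrix.zero_vecMul]

lemma sigM_mem_vZero {n k m : ℕ}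
    (U : Matrix (Fin (2 * (n + m))) (Fin (2 * (n + m))) (ZMod 2)) (i : Fin (n - k)) :
    sigM n k m U i ∈ vZero n k m U := by
  refine le_sup_left (a := sZero n k m U)
    (Submodule.mem_iSup_of_mem 0 ⟨_, Submodule.subset_span ⟨i, rfl⟩, ?_⟩)
  simp

/-- By Fitting's decomposition, 𝒩₀ together with the row space of μ_M spans everything. -/
lemma nZero_sup_range {n m : ℕ}
    (U : Matrix (Fin (2 * (n + m))) (Fin (2 * (n + m))) (ZMod 2)) :
    nZero n m U ⊔ LinearMap.range (muM n m U).vecMulLinear = ⊤ := by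
  have h := (LinearMap.isCompl_iSup_ker_pow_iInf_range_pow (muM n m U).vecMulLinear).sup_eq_top
  rw [eq_top_iff, ← h]
  refine sup_le_sup (iSup_le fun t => ?_) ((iInf_le _ 1).trans (by rw [pow_one]))
  refine le_trans ?_ (le_iSup _ t)
  intro Q hQ
  rw [LinearMap.mem_ker] at hQ ⊢
  rw [vecMulLinear_pow, pow_succ', Module.End.mul_apply, hQ, map_zero]

/-- the kernel graph has constant in-degree 1 and positive out-degree:
(a) every M′ ∈ 𝒱₀^⊥ has exactly one predecessor M ∈ 𝒱₀^⊥ along a physical-weight-0 edge,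
and (b) every M ∈ 𝒱₀^⊥ has a successor M′ ∈ 𝒱₀^⊥ along a physical-weight-0 edge. -/
theorem stmt_15 (n k m : ℕ) (hn : 1 ≤ n) (hk : k ≤ n) (hm : 1 ≤ m)
    (U : Matrix (Fin (2 * (n + m))) (Fin (2 * (n + m))) (ZMod 2))
    (hU : IsSymplectic U) :
    (∀ M' ∈ sperp m (vZero n k m U),
      ∃! M : Fin (2 * m) → ZMod 2,
        M ∈ sperp m (vZero n k m U) ∧
        ∃ (L : Fin (2 * k) → ZMod 2) (S : Fin (n - k) → ZMod 2),
          ZeroPhysEdge n k m hk U M L S M') ∧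
    (∀ M ∈ sperp m (vZero n k m U),
      ∃ M' ∈ sperp m (vZero n k m U),
        ∃ (L : Fin (2 * k) → ZMod 2) (S : Fin (n - k) → ZMod 2),
          ZeroPhysEdge n k m hk U M L S M') := by
  have hmaps : Set.MapsTo (fun M' => Matrix.vecMul M' (symplecticAdjoint (muM n m U)))
      (sperp m (vZero n k m U)) (sperp m (vZero n k m U)) := fun M' hM' T hT => by
    rw [sstar_vecMul_symplecticAdjoint]
    exact hM' _ (vecMul_mem_vZero hT)
  have hinj : Set.InjOn (fun M' => Matrix.vecMul M' (symplecticAdjoint (muM n m U)))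
      (sperp m (vZero n k m U)) := by
    intro P hP Q hQ hPQ
    rw [← sub_eq_zero]
    apply eq_zero_of_sstar_eq_zero
    intro T
    have hT : T ∈ nZero n m U ⊔ LinearMap.range (muM n m U).vecMulLinear := by
      rw [nZero_sup_range]; trivial
    obtain ⟨T₁, hT₁, _, ⟨T₂, rfl⟩, rfl⟩ := Submodule.mem_sup.mp hT
    have hT₁' : T₁ ∈ vZero n k m U := le_sup_right (a := sZero n k m U) hT₁
    rw [sstar_add_right, sstar_sub_left, hP _ hT₁', hQ _ hT₁', Matrix.vecMulLinear_apply,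
      ← sstar_vecMul_symplecticAdjoint, Matrix.sub_vecMul, sub_eq_zero.mpr hPQ]
    simp [sstar]
  have hs : ∀ M' ∈ sperp m (vZero n k m U), ∀ i, sstar M' (sigM n k m U i) = 0 :=
    fun M' hM' i => hM' _ (sigM_mem_vZero U i)
  simp only [exists_zeroPhysEdge_iff hk hU]
  refine ⟨fun M' hM' => ⟨_, ⟨hmaps hM', hs M' hM', rfl⟩, fun M hM => hM.2.2⟩, fun M hM => ?_⟩
  have hsurj := Finite.surjective_of_injective (hmaps.restrict_inj.mpr hinj)
  obtain ⟨M', hM', rfl⟩ := hmaps.restrict_surjective_iff.mp hsurj hM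
  exact ⟨M', hM', hs M' hM', rfl⟩
end

section
/- Let 0 ≤ k < n and let H₁,…,H_{n−k} ∈ F_2^{2n} be linearly independent vectors that are pairwise orthogonal under the Λ_n-symplectic product (the stabilizer generators of a stabilizer code). Suppose there is an index j ∈ {1,…,n} such that every H_i has zero entries in coordinates 2j−1 and 2j (i.e., all stabilizers act trivially on qubit j). Then there exists P ∈ F_2^{2n} of weight 1 such that H_i ⋆ P = 0 for all i and P does not lie in the span of H₁,…,H_{n−k}; consequently the minimum distance of the code — the minimum weight of an element of {Q : H_i ⋆ Q = 0 for all i} not in the span of the H_i — equals 1. -/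
open Matrix

/-- The weight of P ∈ F_2^{2n}: the number of coordinate pairs (P^{2i−1}, P^{2i}) ≠ (0,0). -/
def pairWt (n : ℕ) (P : Fin (2 * n) → ZMod 2) : ℕ :=
  (Finset.univ.filter fun i : Fin n =>
      P ⟨2 * i.val, by have := i.isLt; omega⟩ ≠ 0 ∨
      P ⟨2 * i.val + 1, by have := i.isLt; omega⟩ ≠ 0).card

theorem sstar_single {N : ℕ} (P : Fin (2 * N) → ZMod 2) (a : Fin (2 * N)) :
    sstar P (Pi.single a 1) = ∑ b, if b.val / 2 = a.val / 2 ∧ b ≠ a then P b else 0 := by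
  simp only [sstar, dotProduct_single_one]
  simp [lambdaMat, Matrix.vecMul, dotProduct]

theorem pairWt_single (n : ℕ) (j : Fin n) (h : 2 * j.val < 2 * n) :
    pairWt n (Pi.single ⟨2 * j.val, h⟩ 1) = 1 := by
  rw [pairWt, Finset.card_eq_one]
  refine ⟨j, ?_⟩
  ext i
  simp only [Finset.mem_filter, Finset.mem_univ, true_and, Finset.mem_singleton,
    Pi.single_apply, Fin.ext_iff, ne_eq, ite_eq_right_iff, one_ne_zero, imp_false, not_not]
  omega

theorem eq_zero_of_pairWt_eq_zero {n : ℕ} {P : Fin (2 * n) → ZMod 2} (h : pairWt n P = 0) :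
    P = 0 := by
  rw [pairWt, Finset.card_eq_zero, Finset.filter_eq_empty_iff] at h
  funext a
  have hp := @h ⟨a.val / 2, by omega⟩ (Finset.mem_univ _)
  push Not at hp
  rcases Nat.mod_two_eq_zero_or_one a.val with ha | ha
  · have hidx : a = ⟨2 * (a.val / 2), by omega⟩ := Fin.ext (by simp only; omega)
    rw [hidx]
    exact hp.1
  · have hidx : a = ⟨2 * (a.val / 2) + 1, by omega⟩ := Fin.ext (by simp only; omega)
    rw [hidx]
    exact hp.2

theorem notMem_span_range_of_apply_eq_zero {R ι κ : Type*} [Semiring R] {v : ι → κ → R} {a : κ}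
    (hv : ∀ i, v i a = 0) {x : κ → R} (hx : x a ≠ 0) :
    x ∉ Submodule.span R (Set.range v) := by
  have hle : Submodule.span R (Set.range v) ≤
      LinearMap.ker (LinearMap.proj a : (κ → R) →ₗ[R] R) := by
    rw [Submodule.span_le]
    rintro _ ⟨i, rfl⟩
    exact hv i
  exact fun h => hx (hle h)

/-- if the stabilizer generators H₁,…,H_{n−k} (linearly independent, pairwise
symplectically orthogonal) all act trivially on some qubit j (zero entries at coordinates
2j−1 and 2j), then there is a weight-1 element P commuting with all generators and outside
their span; consequently the minimum distance of the code equals 1. -/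
theorem stmt_19 (n k : ℕ) (hk : k < n)
    (H : Fin (n - k) → (Fin (2 * n) → ZMod 2))
    (hind : LinearIndependent (ZMod 2) H)
    (horth : ∀ i j : Fin (n - k), i ≠ j → sstar (H i) (H j) = 0)
    (htriv : ∃ j : Fin n, ∀ i : Fin (n - k),
        H i ⟨2 * j.val, by have := j.isLt; omega⟩ = 0 ∧
        H i ⟨2 * j.val + 1, by have := j.isLt; omega⟩ = 0) :
    (∃ P : Fin (2 * n) → ZMod 2, pairWt n P = 1 ∧ (∀ i, sstar (H i) P = 0) ∧
        P ∉ Submodule.span (ZMod 2) (Set.range H)) ∧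
    IsLeast {w : ℕ | ∃ Q : Fin (2 * n) → ZMod 2, (∀ i, sstar (H i) Q = 0) ∧
        Q ∉ Submodule.span (ZMod 2) (Set.range H) ∧ pairWt n Q = w} 1 := by
  have hP : ∃ P : Fin (2 * n) → ZMod 2, pairWt n P = 1 ∧ (∀ i, sstar (H i) P = 0) ∧
      P ∉ Submodule.span (ZMod 2) (Set.range H) := by
    obtain ⟨j, hj⟩ := htriv
    have h2j : 2 * j.val < 2 * n := by omega
    refine ⟨Pi.single ⟨2 * j.val, h2j⟩ 1, pairWt_single n j h2j, fun i => ?_,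
      notMem_span_range_of_apply_eq_zero (fun i => (hj i).1) (by simp)⟩
    rw [sstar_single]
    refine Finset.sum_eq_zero fun b _ => ite_eq_right_iff.mpr ?_
    rintro ⟨hb, hne⟩
    convert (hj i).2 using 2
    simp only [ne_eq, Fin.ext_iff] at hb hne ⊢
    omega
  refine ⟨hP, ?_, ?_⟩
  · obtain ⟨P, hw, hc, hs⟩ := hP
    exact ⟨P, hc, hs, hw⟩
  · rintro w ⟨Q, -, hs, rfl⟩
    refine Nat.one_le_iff_ne_zero.mpr fun h => hs ?_
    rw [eq_zero_of_pairWt_eq_zero h]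
    exact Submodule.zero_mem _
end
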